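/- For i ∈ {1,2}, let X^{i,c} be d-dimensional Brownian motions with drift (continuous Lévy processes) in filtrations F^i under P^i, and let T^i be F^i-stopping times with P^i(T^i > 0) > 0. If the laws of X^{1,c} restricted to [0, T^1) and of X^{2,c} restricted to [0, T^2) coincide, then the laws of X^{1,c} restricted to [0, T^1] ∩ [0,∞) and of X^{2,c} restricted to [0, T^2] ∩ [0,∞) coincide (by path continuity), and hence X^{1,c} and X^{2,c} have the same law. -/

import Mathlib

open MeasureTheory ProbabilityTheory Filter Set
open scoped NNReal ENNReal

noncomputable section

instance optMS {α : Type*} [MeasurableSpace α] : MeasurableSpace (Option α) :=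
  MeasurableSpace.comap (fun o => o.elim (Sum.inl ()) Sum.inr) inferInstance

variable {Ω : Type*} {mΩ : MeasurableSpace Ω} {d : ℕ}

/-- Extend a nonnegative Borel function `g` on `ℝ^d` by `0` at the cemetery `∂ = none`. -/
def kval (g : (Fin d → ℝ) → ℝ≥0∞) : Option (Fin d → ℝ) → ℝ≥0∞ := fun x => x.elim 0 g

/-- Difference in `ℝ^d ∪ {∂}`, with the convention `∂ ± x = x ± ∂ = ∂`. -/
def osub : Option (Fin d → ℝ) → Option (Fin d → ℝ) → Option (Fin d → ℝ)
  | some a, some b => some (a - b)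
  | _, _ => none

/-- Sum in `ℝ^d ∪ {∂}`, with the convention `∂ ± x = x ± ∂ = ∂`. -/
def oadd : Option (Fin d → ℝ) → Option (Fin d → ℝ) → Option (Fin d → ℝ)
  | some a, some b => some (a + b)
  | _, _ => none

/-- The lifetime `ζ := inf {t > 0 : X t = ∂}` (`= ∞` if the set is empty). -/
def lifetime (X : ℝ≥0 → Ω → Option (Fin d → ℝ)) (ω : Ω) : ℝ≥0∞ :=
  sInf ((fun s : ℝ≥0 => (s : ℝ≥0∞)) '' {s : ℝ≥0 | 0 < s ∧ X s ω = none})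

/-- The `ℝ^d`-valued path of `X`, read as `0` at the cemetery (used only to express
path regularity on `[0, ζ)`). -/
def pkPath (X : ℝ≥0 → Ω → Option (Fin d → ℝ)) (ω : Ω) (t : ℝ≥0) : Fin d → ℝ :=
  (X t ω).getD 0

/-- A possibly killed `ℝ^d`-valued Lévy process `X` in the filtration `F` under `P`. -/
structure IsPKLevy (P : Measure Ω) (F : Filtration ℝ≥0 mΩ)
    (X : ℝ≥0 → Ω → Option (Fin d → ℝ)) : Prop where
  adapted : ∀ t, Measurable[F t] (X t)
  dead : ∀ ω, ∀ t : ℝ≥0, lifetime X ω ≤ t → X t ω = none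
  rightCont : ∀ ω, ∀ t : ℝ≥0, (t : ℝ≥0∞) < lifetime X ω →
    ContinuousWithinAt (pkPath X ω) (Set.Ici t) t
  leftLim : ∀ ω, ∀ t : ℝ≥0, 0 < t → (t : ℝ≥0∞) ≤ lifetime X ω →
    ∃ l, Tendsto (pkPath X ω) (nhdsWithin t (Set.Iio t)) (nhds l)
  init : ∀ᵐ ω ∂P, X 0 ω = some 0
  alive : ∀ᵐ ω ∂P, 0 < lifetime X ω
  increments : ∀ s t : ℝ≥0, s ≤ t → ∀ g : (Fin d → ℝ) → ℝ≥0∞, Measurable g →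
    ∀ A : Set Ω, MeasurableSet[F s] A →
      ∫⁻ ω in A, kval g (osub (X t ω) (X s ω)) ∂P
        = P (A ∩ {ω | (s : ℝ≥0∞) < lifetime X ω}) * ∫⁻ ω, kval g (X (t - s) ω) ∂P

/-- An `[0,∞]`-valued stopping time of the filtration `F`. -/
def IsStoppingTimeE (F : Filtration ℝ≥0 mΩ) (T : Ω → ℝ≥0∞) : Prop :=
  ∀ t : ℝ≥0, MeasurableSet[F t] {ω | T ω ≤ (t : ℝ≥0∞)}

/-- The law of `X` observed on the random interval `[0, T] ∩ [0, ∞)`: outside the interval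
the observed process is set to the adjoined state `↑` (the outer `none`). -/
def restLawIcc (P : Measure Ω) (X : ℝ≥0 → Ω → Option (Fin d → ℝ)) (T : Ω → ℝ≥0∞) :
    Measure (ℝ≥0 → Option (Option (Fin d → ℝ))) :=
  Measure.map (fun ω t => if (t : ℝ≥0∞) ≤ T ω then some (X t ω) else none) P

/-- The law of `X` observed on the random interval `[0, T)`. -/
def restLawIco (P : Measure Ω) (X : ℝ≥0 → Ω → Option (Fin d → ℝ)) (T : Ω → ℝ≥0∞) :
    Measure (ℝ≥0 → Option (Option (Fin d → ℝ))) :=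
  Measure.map (fun ω t => if (t : ℝ≥0∞) < T ω then some (X t ω) else none) P

/-- The law of the process `X` under `P`. -/
def pkLaw (P : Measure Ω) (X : ℝ≥0 → Ω → Option (Fin d → ℝ)) :
    Measure (ℝ≥0 → Option (Fin d → ℝ)) :=
  Measure.map (fun ω t => X t ω) P

/-- An (unkilled) Lévy process with values in a normed abelian group `V`. -/
structure IsLevy {V : Type*} [NormedAddCommGroup V] [MeasurableSpace V]
    (P : Measure Ω) (F : Filtration ℝ≥0 mΩ) (X : ℝ≥0 → Ω → V) : Prop where
  adapted : ∀ t, Measurable[F t] (X t)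
  rightCont : ∀ ω, ∀ t : ℝ≥0, ContinuousWithinAt (fun s => X s ω) (Set.Ici t) t
  leftLim : ∀ ω, ∀ t : ℝ≥0, 0 < t → ∃ l, Tendsto (fun s => X s ω) (nhdsWithin t (Set.Iio t)) (nhds l)
  init : ∀ᵐ ω ∂P, X 0 ω = 0
  increments : ∀ s t : ℝ≥0, s ≤ t → ∀ g : V → ℝ≥0∞, Measurable g →
    ∀ A : Set Ω, MeasurableSet[F s] A →
      ∫⁻ ω in A, g (X t ω - X s ω) ∂P = P A * ∫⁻ ω, g (X (t - s) ω) ∂P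

lemma opt_measurable_some {α : Type*} [MeasurableSpace α] :
    Measurable (some : α → Option α) := by
  rw [measurable_comap_iff]
  exact measurable_inr

lemma opt_measurable_elim {α β : Type*} [MeasurableSpace α] [MeasurableSpace β]
    (b : β) {f : α → β} (hf : Measurable f) :
    Measurable (fun o : Option α => o.elim b f) := by
  have h : Measurable (Sum.elim (fun _ : Unit => b) f) := measurable_const.sumElim hf
  have h2 : Measurable (fun o : Option α => o.elim (Sum.inl () : Unit ⊕ α) Sum.inr) :=
    comap_measurable _
  convert h.comp h2 using 1
  ext o
  cases o <;> rfl

lemma stop_lt_meas {F : Filtration ℝ≥0 mΩ} {T : Ω → ℝ≥0∞} (hT : IsStoppingTimeE F T) (t : ℝ≥0) :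
    MeasurableSet[F t] {ω | (t : ℝ≥0∞) < T ω} := by
  have := (hT t).compl
  convert this using 1
  ext ω
  simp

lemma stop_measurable {F : Filtration ℝ≥0 mΩ} {T : Ω → ℝ≥0∞} (hT : IsStoppingTimeE F T) :
    Measurable T := by
  refine measurable_of_Iic fun x => ?_
  induction x with
  | top => simp
  | coe x => exact F.le x _ (hT x)

lemma obs_measurable {F : Filtration ℝ≥0 mΩ} {T : Ω → ℝ≥0∞} (hT : IsStoppingTimeE F T)
    {X : ℝ≥0 → Ω → (Fin d → ℝ)} (hX : ∀ t, Measurable (X t)) :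
    Measurable (fun ω (t : ℝ≥0) => if (t : ℝ≥0∞) < T ω then some (X t ω) else none) := by
  refine measurable_pi_lambda _ fun t => ?_
  exact Measurable.ite (F.le t _ (stop_lt_meas hT t)) (opt_measurable_some.comp (hX t))
    measurable_const

/-- approximating times from the left -/
def ltime (t : ℝ≥0) (n : ℕ) : ℝ≥0 := t * (((n : ℝ≥0) + 1) / ((n : ℝ≥0) + 2))

lemma ltime_lt {t : ℝ≥0} (ht : t ≠ 0) (n : ℕ) : ltime t n < t := by
  unfold ltime
  have : ((n : ℝ≥0) + 1) / ((n : ℝ≥0) + 2) < 1 := by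
    rw [div_lt_one (by positivity)]
    gcongr
    norm_num
  calc _ < t * 1 := by
        apply mul_lt_mul_of_pos_left this (pos_iff_ne_zero.2 ht)
    _ = t := mul_one t

lemma ltime_tendsto (t : ℝ≥0) : Tendsto (ltime t) atTop (nhds t) := by
  have h : Tendsto (fun n : ℕ => ((n : ℝ) + 1) / ((n : ℝ) + 2)) atTop (nhds 1) := by
    have h1 : Tendsto (fun n : ℕ => 1 - 1 / (((n + 1 : ℕ) : ℝ) + 1)) atTop (nhds (1 - 0)) :=
      tendsto_const_nhds.sub
        ((tendsto_one_div_add_atTop_nhds_zero_nat (𝕜 := ℝ)).comp (tendsto_add_atTop_nat 1))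
    rw [sub_zero] at h1
    refine h1.congr fun n => ?_
    push_cast
    field_simp
    ring
  have h2 : Tendsto (fun n : ℕ => ((n : ℝ≥0) + 1) / ((n : ℝ≥0) + 2)) atTop (nhds 1) := by
    rw [← NNReal.tendsto_coe]
    push_cast
    exact h
  have h3 := h2.const_mul t
  rw [mul_one] at h3
  exact h3

open Classical in
/-- Reconstruct the closed-interval observation from the half-open one. -/
def closeUp (y : ℝ≥0 → Option (Fin d → ℝ)) (t : ℝ≥0) : Option (Fin d → ℝ) :=
  if t = 0 then some 0 else
    if ∀ n, (y (ltime t n)).elim False (fun _ => True) then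
      some (fun i => limsup (fun n => (y (ltime t n)).elim 0 (fun x => x i)) atTop) else none

lemma closeUp_measurable : Measurable (closeUp (d := d)) := by
  classical
  refine measurable_pi_lambda _ fun t => ?_
  unfold closeUp
  by_cases ht : t = 0
  · simp only [ht, if_true]; exact measurable_const
  simp only [ht, if_false]
  refine Measurable.ite ?_ (opt_measurable_some.comp ?_) measurable_const
  · have : Measurable (fun y : ℝ≥0 → Option (Fin d → ℝ) =>
        ∀ n, (y (ltime t n)).elim False (fun _ => True)) := by
      refine Measurable.forall fun n => ?_
      exact (opt_measurable_elim False (measurable_const (a := True))).comp (measurable_pi_apply _)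
    exact measurableSet_setOfPred.2 this
  · refine measurable_pi_lambda _ fun i => ?_
    refine Measurable.limsup fun n => ?_
    exact (opt_measurable_elim (0 : ℝ) (measurable_pi_apply i)).comp (measurable_pi_apply (ltime t n))

lemma closeUp_obs {T : ℝ≥0∞} {x : ℝ≥0 → (Fin d → ℝ)} (h0 : x 0 = 0) (hx : Continuous x) :
    closeUp (fun t : ℝ≥0 => if (t : ℝ≥0∞) < T then some (x t) else none)
      = fun t : ℝ≥0 => if (t : ℝ≥0∞) ≤ T then some (x t) else none := by
  classical
  ext1 t
  unfold closeUp
  by_cases ht : t = 0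
  · simp [ht, h0]
  simp only [ht, if_false]
  by_cases hT : (t : ℝ≥0∞) ≤ T
  · have hlt : ∀ n, ((ltime t n : ℝ≥0) : ℝ≥0∞) < T := fun n =>
      (ENNReal.coe_lt_coe.2 (ltime_lt ht n)).trans_le hT
    simp only [hlt, if_true, hT, Option.elim]
    simp only [implies_true, if_true, Option.some.injEq]
    ext i
    apply Tendsto.limsup_eq
    exact (((continuous_apply i).comp hx).tendsto t).comp (ltime_tendsto t)
  · rw [if_neg, if_neg hT]
    intro h
    apply hT
    have hlt : ∀ n, ((ltime t n : ℝ≥0) : ℝ≥0∞) < T := by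
      intro n
      by_contra hc
      simpa [hc] using h n
    exact le_of_tendsto (ENNReal.tendsto_coe.2 (ltime_tendsto t))
      (Eventually.of_forall fun n => (hlt n).le)

lemma closed_law {P : Measure Ω} {F : Filtration ℝ≥0 mΩ}
    {X : ℝ≥0 → Ω → (Fin d → ℝ)} (hX : IsLevy P F X)
    (hcont : ∀ ω, Continuous fun t => X t ω)
    {T : Ω → ℝ≥0∞} (hT : IsStoppingTimeE F T) :
    Measure.map (fun ω (t : ℝ≥0) => if (t : ℝ≥0∞) ≤ T ω then some (X t ω) else none) P
      = (Measure.map (fun ω (t : ℝ≥0) => if (t : ℝ≥0∞) < T ω then some (X t ω) else none) P).map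
        closeUp := by
  rw [Measure.map_map closeUp_measurable
    (obs_measurable hT fun t => (hX.adapted t).mono (F.le t) le_rfl)]
  refine Measure.map_congr ?_
  filter_upwards [hX.init] with ω hω
  exact (closeUp_obs hω (hcont ω)).symm

/-- The character. -/
def ee (L : StrongDual ℝ (Fin d → ℝ)) (x : Fin d → ℝ) : ℂ := Complex.exp (L x * Complex.I)

lemma ee_norm (L : StrongDual ℝ (Fin d → ℝ)) (x : Fin d → ℝ) : ‖ee L x‖ = 1 :=
  Complex.norm_exp_ofReal_mul_I _

lemma ee_cont (L : StrongDual ℝ (Fin d → ℝ)) : Continuous (ee L) := by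
  unfold ee; fun_prop

lemma ee_add (L : StrongDual ℝ (Fin d → ℝ)) (x y : Fin d → ℝ) :
    ee L (x + y) = ee L x * ee L y := by
  simp [ee, ← Complex.exp_add, add_mul]

lemma ee_zero (L : StrongDual ℝ (Fin d → ℝ)) : ee L 0 = 1 := by simp [ee]

/-- The characteristic function of `X t`. -/
def cf (P : Measure Ω) (X : ℝ≥0 → Ω → (Fin d → ℝ)) (L : StrongDual ℝ (Fin d → ℝ)) (t : ℝ≥0) : ℂ :=
  ∫ ω, ee L (X t ω) ∂P

lemma levy_meas {P : Measure Ω} {F : Filtration ℝ≥0 mΩ}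
    {X : ℝ≥0 → Ω → (Fin d → ℝ)} (hX : IsLevy P F X) (t : ℝ≥0) : Measurable (X t) :=
  (hX.adapted t).mono (F.le t) le_rfl

lemma levy_inter {P : Measure Ω} {F : Filtration ℝ≥0 mΩ}
    {X : ℝ≥0 → Ω → (Fin d → ℝ)} (hX : IsLevy P F X) {s t : ℝ≥0} (hst : s ≤ t)
    {A : Set Ω} (hA : MeasurableSet[F s] A) {B : Set (Fin d → ℝ)} (hB : MeasurableSet B) :
    P (A ∩ (fun ω => X t ω - X s ω) ⁻¹' B) = P A * P (X (t - s) ⁻¹' B) := by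
  have h := hX.increments s t hst (B.indicator 1) (measurable_one.indicator hB) A hA
  have hm : Measurable (fun ω => X t ω - X s ω) := (levy_meas hX t).sub (levy_meas hX s)
  have e1 : ∀ f : Ω → (Fin d → ℝ), (fun ω => B.indicator (1 : (Fin d → ℝ) → ℝ≥0∞) (f ω))
      = (f ⁻¹' B).indicator 1 := fun f => rfl
  have h1 := e1 (fun ω => X t ω - X s ω)
  have h2 := e1 (X (t - s))
  rw [h1, h2, lintegral_indicator_one (hm hB), lintegral_indicator_one (levy_meas hX _ hB),
    Measure.restrict_apply (hm hB), inter_comm] at h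
  exact h

lemma levy_incr {P : Measure Ω} [IsProbabilityMeasure P] {F : Filtration ℝ≥0 mΩ}
    {X : ℝ≥0 → Ω → (Fin d → ℝ)} (hX : IsLevy P F X) {s t : ℝ≥0} (hst : s ≤ t)
    {W : Ω → ℂ} (hW : Measurable[F s] W) (L : StrongDual ℝ (Fin d → ℝ)) :
    ∫ ω, W ω * ee L (X t ω - X s ω) ∂P = (∫ ω, W ω ∂P) * cf P X L (t - s) := by
  have hm : Measurable (fun ω => X t ω - X s ω) := (levy_meas hX t).sub (levy_meas hX s)
  have hlaw : ∀ B, MeasurableSet B → P ((fun ω => X t ω - X s ω) ⁻¹' B) = P (X (t - s) ⁻¹' B) := by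
    intro B hB
    have := levy_inter hX hst (A := univ) MeasurableSet.univ hB
    simpa using this
  have hmap : P.map (fun ω => X t ω - X s ω) = P.map (X (t - s)) := by
    ext B hB
    rw [Measure.map_apply hm hB, Measure.map_apply (levy_meas hX _) hB, hlaw B hB]
  have hind : IndepFun W (fun ω => X t ω - X s ω) P := by
    rw [indepFun_iff_measure_inter_preimage_eq_mul]
    intro A B hA hB
    rw [levy_inter hX hst (hW hA) hB, hlaw B hB]
  have hind2 : IndepFun W (fun ω => ee L (X t ω - X s ω)) P :=
    hind.comp measurable_id (ee_cont L).measurable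
  rw [hind2.integral_fun_mul_eq_mul_integral
    ((hW.mono (F.le s) le_rfl).aestronglyMeasurable)
    (((ee_cont L).measurable.comp hm).aestronglyMeasurable)]
  congr 1
  unfold cf
  rw [← integral_map (f := ee L) hm.aemeasurable (ee_cont L).aestronglyMeasurable,
    hmap, integral_map (levy_meas hX _).aemeasurable (ee_cont L).aestronglyMeasurable]

lemma cf_zero {P : Measure Ω} [IsProbabilityMeasure P] {F : Filtration ℝ≥0 mΩ}
    {X : ℝ≥0 → Ω → (Fin d → ℝ)} (hX : IsLevy P F X) (L : StrongDual ℝ (Fin d → ℝ)) :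
    cf P X L 0 = 1 := by
  unfold cf
  rw [integral_congr_ae (g := fun _ => (1 : ℂ))]
  · simp
  · filter_upwards [hX.init] with ω h
    rw [h, ee_zero]

lemma cf_add {P : Measure Ω} [IsProbabilityMeasure P] {F : Filtration ℝ≥0 mΩ}
    {X : ℝ≥0 → Ω → (Fin d → ℝ)} (hX : IsLevy P F X) (L : StrongDual ℝ (Fin d → ℝ)) (s h : ℝ≥0) :
    cf P X L (s + h) = cf P X L s * cf P X L h := by
  have := levy_incr hX (le_self_add : s ≤ s + h) (W := fun ω => ee L (X s ω))
    ((ee_cont L).measurable.comp (hX.adapted s)) L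
  rw [add_tsub_cancel_left] at this
  rw [show cf P X L s = ∫ ω, ee L (X s ω) ∂P from rfl, ← this]
  unfold cf
  congr 1 with ω
  rw [← ee_add]
  simp

lemma cf_nat {P : Measure Ω} [IsProbabilityMeasure P] {F : Filtration ℝ≥0 mΩ}
    {X : ℝ≥0 → Ω → (Fin d → ℝ)} (hX : IsLevy P F X) (L : StrongDual ℝ (Fin d → ℝ)) (h : ℝ≥0)
    (n : ℕ) : cf P X L (n * h) = cf P X L h ^ n := by
  induction n with
  | zero => simp [cf_zero hX]
  | succ n ih => rw [pow_succ, ← ih, ← cf_add hX]; congr 1; push_cast; ring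

lemma cf_norm {P : Measure Ω} [IsProbabilityMeasure P]
    {X : ℝ≥0 → Ω → (Fin d → ℝ)} (L : StrongDual ℝ (Fin d → ℝ)) (h : ℝ≥0) :
    ‖cf P X L h‖ ≤ 1 := by
  unfold cf
  refine (norm_integral_le_of_norm_le_const (C := 1) (Eventually.of_forall fun ω => ?_)).trans ?_
  · rw [ee_norm]
  · simp

/-- Finite-dimensional characteristic functions. -/
lemma fdd_cf {Ω₁ : Type*} {mΩ₁ : MeasurableSpace Ω₁} {Ω₂ : Type*} {mΩ₂ : MeasurableSpace Ω₂}
    {P₁ : Measure Ω₁} [IsProbabilityMeasure P₁] {F₁ : Filtration ℝ≥0 mΩ₁}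
    {X₁ : ℝ≥0 → Ω₁ → (Fin d → ℝ)} (hX₁ : IsLevy P₁ F₁ X₁)
    {P₂ : Measure Ω₂} [IsProbabilityMeasure P₂] {F₂ : Filtration ℝ≥0 mΩ₂}
    {X₂ : ℝ≥0 → Ω₂ → (Fin d → ℝ)} (hX₂ : IsLevy P₂ F₂ X₂)
    (h : ∀ L t, cf P₁ X₁ L t = cf P₂ X₂ L t) (I : Finset ℝ≥0) :
    ∀ L : ℝ≥0 → StrongDual ℝ (Fin d → ℝ),
      ∫ ω, ∏ k ∈ I, ee (L k) (X₁ k ω) ∂P₁ = ∫ ω, ∏ k ∈ I, ee (L k) (X₂ k ω) ∂P₂ := by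
  induction I using Finset.induction_on_max with
  | empty => intro L; simp
  | insert a I hlt ih =>
    intro L
    have ha : a ∉ I := fun hc => lt_irrefl _ (hlt a hc)
    rcases I.eq_empty_or_nonempty with rfl | hne
    · simpa [cf] using h (L a) a
    obtain ⟨m, hm, hmax⟩ := I.exists_max_image id hne
    have hma : m ≤ a := (hlt m hm).le
    let Lnew : ℝ≥0 → StrongDual ℝ (Fin d → ℝ) := Function.update L m (L m + L a)
    have key : ∀ x : ℝ≥0 → (Fin d → ℝ), ∏ k ∈ insert a I, ee (L k) (x k)
        = (∏ k ∈ I, ee (Lnew k) (x k)) * ee (L a) (x a - x m) := by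
      intro x
      rw [Finset.prod_insert ha, ← Finset.mul_prod_erase I _ hm, ← Finset.mul_prod_erase I _ hm]
      have h1 : ∏ k ∈ I.erase m, ee (Lnew k) (x k) = ∏ k ∈ I.erase m, ee (L k) (x k) := by
        refine Finset.prod_congr rfl fun k hk => ?_
        simp [Lnew, Function.update_of_ne (Finset.ne_of_mem_erase hk)]
      have h2 : ee (Lnew m) (x m) = ee (L m) (x m) * ee (L a) (x m) := by
        simp [Lnew, ee, ← Complex.exp_add, add_mul]
      have h3 : ee (L a) (x a) = ee (L a) (x m) * ee (L a) (x a - x m) := by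
        rw [← ee_add]; simp
      rw [h1, h2, h3]
      ring
    simp_rw [key (fun k => X₁ k _), key (fun k => X₂ k _)]
    rw [levy_incr hX₁ hma, levy_incr hX₂ hma, ih, h]
    · refine Finset.measurable_prod _ fun k hk => (ee_cont _).measurable.comp ?_
      exact (hX₂.adapted k).mono (F₂.mono (hmax k hk)) le_rfl
    · refine Finset.measurable_prod _ fun k hk => (ee_cont _).measurable.comp ?_
      exact (hX₁.adapted k).mono (F₁.mono (hmax k hk)) le_rfl

lemma law_of_cf {Ω₁ : Type*} {mΩ₁ : MeasurableSpace Ω₁} {Ω₂ : Type*} {mΩ₂ : MeasurableSpace Ω₂}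
    {P₁ : Measure Ω₁} [IsProbabilityMeasure P₁] {F₁ : Filtration ℝ≥0 mΩ₁}
    {X₁ : ℝ≥0 → Ω₁ → (Fin d → ℝ)} (hX₁ : IsLevy P₁ F₁ X₁)
    {P₂ : Measure Ω₂} [IsProbabilityMeasure P₂] {F₂ : Filtration ℝ≥0 mΩ₂}
    {X₂ : ℝ≥0 → Ω₂ → (Fin d → ℝ)} (hX₂ : IsLevy P₂ F₂ X₂)
    (h : ∀ L t, cf P₁ X₁ L t = cf P₂ X₂ L t) :
    Measure.map (fun ω (t : ℝ≥0) => X₁ t ω) P₁ = Measure.map (fun ω (t : ℝ≥0) => X₂ t ω) P₂ := by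
  have m1 : Measurable (fun ω (t : ℝ≥0) => X₁ t ω) := measurable_pi_lambda _ (levy_meas hX₁)
  have m2 : Measurable (fun ω (t : ℝ≥0) => X₂ t ω) := measurable_pi_lambda _ (levy_meas hX₂)
  have p1 := Measure.isProbabilityMeasure_map (μ := P₁) m1.aemeasurable
  have p2 := Measure.isProbabilityMeasure_map (μ := P₂) m2.aemeasurable
  refine IsProjectiveLimit.unique
    (P := fun I => (Measure.map (fun ω (t : ℝ≥0) => X₂ t ω) P₂).map I.restrict) ?_ (fun I => rfl)
  intro I
  refine Measure.ext_of_charFunDual ?_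
  ext L
  beta_reduce
  rw [charFunDual_apply, charFunDual_apply,
    Measure.map_map (Finset.measurable_restrict I) m1,
    Measure.map_map (Finset.measurable_restrict I) m2,
    integral_map ((Finset.measurable_restrict I).comp m1).aemeasurable (by fun_prop),
    integral_map ((Finset.measurable_restrict I).comp m2).aemeasurable (by fun_prop)]
  classical
  let Lnew : ℝ≥0 → StrongDual ℝ (Fin d → ℝ) := fun k =>
    if hk : k ∈ I then L.comp (ContinuousLinearMap.single ℝ (fun _ : I => (Fin d → ℝ)) ⟨k, hk⟩) else 0
  have key : ∀ x : ℝ≥0 → (Fin d → ℝ), Complex.exp (L (I.restrict x) * Complex.I)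
      = ∏ k ∈ I, ee (Lnew k) (x k) := by
    intro x
    have : L (I.restrict x) = ∑ k ∈ I, Lnew k (x k) := by
      rw [← Finset.sum_coe_sort I]
      conv_lhs => rw [← Finset.univ_sum_single (I.restrict x), map_sum]
      refine Finset.sum_congr rfl fun k _ => ?_
      simp [Lnew]
    rw [this]
    unfold ee
    rw [← Complex.exp_sum]
    push_cast
    rw [Finset.sum_mul]
  simp only [Function.comp_apply, key]
  exact fdd_cf hX₁ hX₂ h I Lnew

/-- Indicator of `s < T`. -/
def ind (T : ℝ≥0∞) (s : ℝ≥0) : ℝ := if (s : ℝ≥0∞) < T then 1 else 0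

lemma ind_anti (T : ℝ≥0∞) {s t : ℝ≥0} (h : s ≤ t) : ind T t ≤ ind T s := by
  unfold ind
  split_ifs with h1 h2
  · rfl
  · exact absurd ((ENNReal.coe_le_coe.2 h).trans_lt h1) h2
  · norm_num
  · rfl

lemma ind_nonneg (T : ℝ≥0∞) (s : ℝ≥0) : 0 ≤ ind T s := by
  unfold ind; split_ifs <;> norm_num

lemma ind_le_one (T : ℝ≥0∞) (s : ℝ≥0) : ind T s ≤ 1 := by
  unfold ind; split_ifs <;> norm_num

lemma ind_meas {F : Filtration ℝ≥0 mΩ} {T : Ω → ℝ≥0∞} (hT : IsStoppingTimeE F T) (s : ℝ≥0) :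
    Measurable[F s] (fun ω => ((ind (T ω) s : ℝ) : ℂ)) := by
  have : Measurable[F s] (fun ω => ind (T ω) s) :=
    Measurable.ite (stop_lt_meas hT s) measurable_const measurable_const
  exact Complex.measurable_ofReal.comp this

/-- The observable functionals. -/
def HH (P : Measure Ω) (X : ℝ≥0 → Ω → (Fin d → ℝ)) (T : Ω → ℝ≥0∞)
    (L : StrongDual ℝ (Fin d → ℝ)) (s t : ℝ≥0) : ℂ :=
  ∫ ω, (ind (T ω) t : ℂ) * ee L (X s ω) ∂P

lemma HH_integrable {P : Measure Ω} [IsProbabilityMeasure P] {F : Filtration ℝ≥0 mΩ}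
    {X : ℝ≥0 → Ω → (Fin d → ℝ)} (hX : IsLevy P F X) {T : Ω → ℝ≥0∞} (hT : IsStoppingTimeE F T)
    (L : StrongDual ℝ (Fin d → ℝ)) (s t : ℝ≥0) :
    Integrable (fun ω => (ind (T ω) t : ℂ) * ee L (X s ω)) P := by
  have hm : Measurable (fun ω => (ind (T ω) t : ℂ) * ee L (X s ω)) :=
    ((ind_meas hT t).mono (F.le t) le_rfl).mul ((ee_cont L).measurable.comp (levy_meas hX s))
  refine Integrable.of_bound hm.aestronglyMeasurable 1 (Eventually.of_forall fun ω => ?_)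
  rw [norm_mul, ee_norm, mul_one, Complex.norm_real, Real.norm_of_nonneg (ind_nonneg _ _)]
  exact ind_le_one _ _

lemma HH_step {P : Measure Ω} [IsProbabilityMeasure P] {F : Filtration ℝ≥0 mΩ}
    {X : ℝ≥0 → Ω → (Fin d → ℝ)} (hX : IsLevy P F X) {T : Ω → ℝ≥0∞} (hT : IsStoppingTimeE F T)
    (L : StrongDual ℝ (Fin d → ℝ)) (s h : ℝ≥0) :
    HH P X T L (s + h) s = HH P X T L s s * cf P X L h := by
  have := levy_incr hX (le_self_add : s ≤ s + h)
    (W := fun ω => (ind (T ω) s : ℂ) * ee L (X s ω))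
    ((ind_meas hT s).mul ((ee_cont L).measurable.comp (hX.adapted s))) L
  rw [add_tsub_cancel_left] at this
  rw [show HH P X T L s s = ∫ ω, (ind (T ω) s : ℂ) * ee L (X s ω) ∂P from rfl, ← this]
  unfold HH
  congr 1 with ω
  rw [mul_assoc, ← ee_add]
  simp

/-- The discretisation error. -/
def DD (P : Measure Ω) (X : ℝ≥0 → Ω → (Fin d → ℝ)) (T : Ω → ℝ≥0∞)
    (L : StrongDual ℝ (Fin d → ℝ)) (h : ℝ≥0) (n : ℕ) : ℂ :=
  ∫ ω, ∑ k ∈ Finset.range n, ((ind (T ω) (k * h) - ind (T ω) ((k + 1 : ℕ) * h) : ℝ) : ℂ) *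
    (ee L (X ((k + 1 : ℕ) * h) ω) - ee L (X (k * h) ω)) ∂P

lemma decomp {P : Measure Ω} [IsProbabilityMeasure P] {F : Filtration ℝ≥0 mΩ}
    {X : ℝ≥0 → Ω → (Fin d → ℝ)} (hX : IsLevy P F X) {T : Ω → ℝ≥0∞} (hT : IsStoppingTimeE F T)
    (L : StrongDual ℝ (Fin d → ℝ)) (h : ℝ≥0) (n : ℕ) :
    (∑ k ∈ Finset.range n, HH P X T L (k * h) (k * h)) * (cf P X L h - 1) =
      ∑ k ∈ Finset.range n, (HH P X T L ((k + 1 : ℕ) * h) ((k + 1 : ℕ) * h)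
        - HH P X T L (k * h) ((k + 1 : ℕ) * h)) + DD P X T L h n := by
  have hi := HH_integrable hX hT L
  have e : ∀ a b : ℝ≥0, (fun ω => ((ind (T ω) a - ind (T ω) b : ℝ) : ℂ) *
      (ee L (X b ω) - ee L (X a ω))) = (fun ω =>
        ((ind (T ω) a : ℂ) * ee L (X b ω) - (ind (T ω) a : ℂ) * ee L (X a ω)) -
        ((ind (T ω) b : ℂ) * ee L (X b ω) - (ind (T ω) b : ℂ) * ee L (X a ω))) := by
    intro a b; ext ω; push_cast; ring
  have e1 : ∀ a b : ℝ≥0, Integrable (fun ω => ((ind (T ω) a - ind (T ω) b : ℝ) : ℂ) *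
      (ee L (X b ω) - ee L (X a ω))) P := by
    intro a b
    rw [e]
    exact ((hi _ _).sub (hi _ _)).sub ((hi _ _).sub (hi _ _))
  have e2 : ∀ a b : ℝ≥0, ∫ ω, ((ind (T ω) a - ind (T ω) b : ℝ) : ℂ) *
      (ee L (X b ω) - ee L (X a ω)) ∂P = (HH P X T L b a - HH P X T L a a) -
        (HH P X T L b b - HH P X T L a b) := by
    intro a b
    rw [e, integral_sub, integral_sub (hi _ _) (hi _ _), integral_sub (hi _ _) (hi _ _)]
    · rfl
    · exact (hi _ _).sub (hi _ _)
    · exact (hi _ _).sub (hi _ _)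
  unfold DD
  rw [integral_finsetSum _ (fun k _ => e1 _ _), ← Finset.sum_add_distrib, Finset.sum_mul]
  refine Finset.sum_congr rfl fun k _ => ?_
  rw [e2]
  have := HH_step hX hT L (k * h) h
  rw [show (k : ℝ≥0) * h + h = ((k + 1 : ℕ) : ℝ≥0) * h by push_cast; ring] at this
  rw [this]
  ring

lemma path_bound (T : ℝ≥0∞) (g : ℝ≥0 → ℂ) (h : ℝ≥0) (n : ℕ) (C : ℝ) (hC : 0 ≤ C)
    (hg : ∀ k < n, ‖g ((k + 1 : ℕ) * h) - g (k * h)‖ ≤ C) :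
    ‖∑ k ∈ Finset.range n, ((ind T (k * h) - ind T ((k + 1 : ℕ) * h) : ℝ) : ℂ) *
      (g ((k + 1 : ℕ) * h) - g (k * h))‖ ≤ C := by
  calc _ ≤ ∑ k ∈ Finset.range n, (ind T (k * h) - ind T ((k + 1 : ℕ) * h)) * C := by
        refine norm_sum_le_of_le _ fun k hk => ?_
        have h0 : 0 ≤ ind T (k * h) - ind T ((k + 1 : ℕ) * h) := by
          rw [sub_nonneg]
          apply ind_anti
          gcongr
          simp
        rw [norm_mul, Complex.norm_real, Real.norm_of_nonneg h0]
        exact mul_le_mul_of_nonneg_left (hg k (Finset.mem_range.1 hk)) h0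
    _ = (ind T ((0 : ℕ) * h) - ind T ((n : ℕ) * h)) * C := by
        rw [← Finset.sum_mul, Finset.sum_range_sub' (fun k : ℕ => ind T (k * h))]
    _ ≤ 1 * C := by
        gcongr
        linarith [ind_le_one T ((0 : ℕ) * h), ind_nonneg T ((n : ℕ) * h)]
    _ = C := one_mul C

lemma path_tendsto (T : ℝ≥0∞) (g : ℝ≥0 → ℂ) (hg : Continuous g) (t : ℝ≥0) :
    Tendsto (fun n : ℕ => ∑ k ∈ Finset.range n,
      ((ind T (k * (t / n)) - ind T ((k + 1 : ℕ) * (t / n)) : ℝ) : ℂ) *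
      (g ((k + 1 : ℕ) * (t / n)) - g (k * (t / n)))) atTop (nhds 0) := by
  rw [Metric.tendsto_atTop]
  intro ε hε
  have hu := (isCompact_Icc (a := (0 : ℝ≥0)) (b := t)).uniformContinuousOn_of_continuous
    hg.continuousOn
  rw [Metric.uniformContinuousOn_iff] at hu
  obtain ⟨δ, hδ, hu⟩ := hu (ε / 2) (half_pos hε)
  have hlim : Tendsto (fun n : ℕ => (t : ℝ) / n) atTop (nhds 0) :=
    tendsto_const_div_atTop_nhds_zero_nat _
  obtain ⟨N, hN⟩ := (hlim.eventually (gt_mem_nhds hδ)).exists_forall_of_atTop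
  refine ⟨max N 1, fun n hn => ?_⟩
  have hn1 : 1 ≤ n := (le_max_right _ _).trans hn
  have hn0 : (n : ℝ≥0) ≠ 0 := by positivity
  rw [dist_zero_right]
  refine (path_bound T g _ n (ε / 2) (half_pos hε).le fun k hk => ?_).trans_lt (half_lt_self hε)
  rw [← dist_eq_norm]
  have hle : ∀ j : ℕ, j ≤ n → (j : ℝ≥0) * (t / n) ∈ Icc 0 t := by
    intro j hj
    refine ⟨zero_le, ?_⟩
    calc (j : ℝ≥0) * (t / n) ≤ n * (t / n) := by gcongr
      _ = t := mul_div_cancel₀ _ hn0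
  refine (hu _ (hle _ hk) _ (hle _ hk.le) ?_).le
  rw [NNReal.dist_eq]
  push_cast
  rw [show ((k : ℝ) + 1) * (t / n) - k * (t / n) = t / n by ring, abs_of_nonneg (by positivity)]
  exact hN n ((le_max_left _ _).trans hn)

lemma DD_tendsto {P : Measure Ω} [IsProbabilityMeasure P] {F : Filtration ℝ≥0 mΩ}
    {X : ℝ≥0 → Ω → (Fin d → ℝ)} (hX : IsLevy P F X) (hcont : ∀ ω, Continuous fun t => X t ω)
    {T : Ω → ℝ≥0∞} (hT : IsStoppingTimeE F T)
    (L : StrongDual ℝ (Fin d → ℝ)) (t : ℝ≥0) :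
    Tendsto (fun n : ℕ => DD P X T L (t / n) n) atTop (nhds 0) := by
  unfold DD
  rw [show (0 : ℂ) = ∫ _ω, (0 : ℂ) ∂P by simp]
  refine tendsto_integral_of_dominated_convergence (fun _ => 2) (fun n => ?_)
    (integrable_const _) (fun n => Eventually.of_forall fun ω => ?_)
    (Eventually.of_forall fun ω => ?_)
  · refine Measurable.aestronglyMeasurable ?_
    have hi : ∀ s, Measurable (fun ω => ind (T ω) s) := fun s =>
      Measurable.ite (F.le s _ (stop_lt_meas hT s)) measurable_const measurable_const
    have he : ∀ s, Measurable (fun ω => ee L (X s ω)) := fun s =>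
      (ee_cont L).measurable.comp (levy_meas hX s)
    refine Finset.measurable_sum _ fun k _ => ?_
    exact (Complex.measurable_ofReal.comp ((hi _).sub (hi _))).mul ((he _).sub (he _))
  · refine path_bound (T ω) (fun s => ee L (X s ω)) _ n 2 (by norm_num) fun k _ => ?_
    refine (norm_sub_le _ _).trans ?_
    rw [ee_norm, ee_norm]; norm_num
  · exact path_tendsto (T ω) (fun s => ee L (X s ω)) ((ee_cont L).comp (hcont ω)) t

lemma HH_tendsto {P : Measure Ω} [IsProbabilityMeasure P] {F : Filtration ℝ≥0 mΩ}
    {X : ℝ≥0 → Ω → (Fin d → ℝ)} (hX : IsLevy P F X) (hcont : ∀ ω, Continuous fun t => X t ω)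
    {T : Ω → ℝ≥0∞} (hT : IsStoppingTimeE F T)
    (L : StrongDual ℝ (Fin d → ℝ)) :
    Tendsto (fun s : ℝ≥0 => HH P X T L s s) (nhds 0) (nhds ((P.real {ω | 0 < T ω} : ℝ) : ℂ)) := by
  have h0 : ((P.real {ω | 0 < T ω} : ℝ) : ℂ) = ∫ ω, (ind (T ω) 0 : ℂ) ∂P := by
    rw [integral_complex_ofReal]
    congr 1
    have hm : MeasurableSet {ω | 0 < T ω} := by
      have := F.le 0 _ (stop_lt_meas hT 0)
      simpa using this
    rw [← integral_indicator_one hm]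
    congr 1 with ω
    simp [ind, indicator]
  rw [h0]
  unfold HH
  refine tendsto_integral_filter_of_dominated_convergence (fun _ => 1)
    (Eventually.of_forall fun s => (HH_integrable hX hT L s s).aestronglyMeasurable)
    (Eventually.of_forall fun s => Eventually.of_forall fun ω => ?_)
    (integrable_const _) ?_
  · rw [norm_mul, ee_norm, mul_one, Complex.norm_real, Real.norm_of_nonneg (ind_nonneg _ _)]
    exact ind_le_one _ _
  · filter_upwards [hX.init] with ω hω
    have h1 : Tendsto (fun s => ee L (X s ω)) (nhds 0) (nhds 1) := by
      have := ((ee_cont L).comp (hcont ω)).tendsto 0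
      simpa [hω, ee_zero, Function.comp_def] using this
    have h2 : Tendsto (fun s => (ind (T ω) s : ℂ)) (nhds 0) (nhds (ind (T ω) 0 : ℂ)) := by
      by_cases hT0 : 0 < T ω
      · refine tendsto_const_nhds.congr' ?_
        have : Tendsto (fun s : ℝ≥0 => (s : ℝ≥0∞)) (nhds 0) (nhds ((0 : ℝ≥0) : ℝ≥0∞)) :=
          ENNReal.tendsto_coe.2 tendsto_id
        filter_upwards [this.eventually (gt_mem_nhds (by simpa using hT0))] with s hs
        simp [ind, hs, hT0]
      · have : T ω = 0 := by simpa using hT0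
        simp [ind, this]
    simpa using h2.mul h1

lemma HH_obs {P : Measure Ω} {F : Filtration ℝ≥0 mΩ}
    {X : ℝ≥0 → Ω → (Fin d → ℝ)} (hX : IsLevy P F X)
    {T : Ω → ℝ≥0∞} (hT : IsStoppingTimeE F T)
    (L : StrongDual ℝ (Fin d → ℝ)) {s t : ℝ≥0} (hst : s ≤ t) :
    HH P X T L s t = ∫ y : ℝ≥0 → Option (Fin d → ℝ),
      (y t).elim 0 (fun _ => (1 : ℂ)) * (y s).elim 0 (ee L)
      ∂(Measure.map (fun ω (t : ℝ≥0) => if (t : ℝ≥0∞) < T ω then some (X t ω) else none) P) := by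
  rw [integral_map (obs_measurable hT (levy_meas hX)).aemeasurable]
  · unfold HH
    congr 1 with ω
    unfold ind
    by_cases h : (t : ℝ≥0∞) < T ω
    · have hlt2 : (s : ℝ≥0∞) < T ω := (ENNReal.coe_le_coe.2 hst).trans_lt h
      simp [h, hlt2]
    · simp [h]
  · refine Measurable.aestronglyMeasurable ?_
    exact ((opt_measurable_elim 0 measurable_const).comp (measurable_pi_apply t)).mul
      ((opt_measurable_elim 0 (ee_cont L).measurable).comp (measurable_pi_apply s))

lemma pow_diff (z w : ℂ) (hz : ‖z‖ ≤ 1) (hw : ‖w‖ ≤ 1) (n : ℕ) :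
    ‖z ^ n - w ^ n‖ ≤ n * ‖z - w‖ := by
  induction n with
  | zero => simp
  | succ n ih =>
    have : z ^ (n + 1) - w ^ (n + 1) = z ^ n * (z - w) + (z ^ n - w ^ n) * w := by ring
    rw [this]
    refine (norm_add_le _ _).trans ?_
    rw [norm_mul, norm_mul, norm_pow]
    have h1 : ‖z‖ ^ n ≤ 1 := pow_le_one₀ (norm_nonneg _) hz
    have h2 : ‖z‖ ^ n * ‖z - w‖ ≤ 1 * ‖z - w‖ := by gcongr
    have h3 : ‖z ^ n - w ^ n‖ * ‖w‖ ≤ (n * ‖z - w‖) * 1 := by gcongr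
    push_cast
    linarith

lemma cf_eq {Ω₁ : Type*} {mΩ₁ : MeasurableSpace Ω₁} {Ω₂ : Type*} {mΩ₂ : MeasurableSpace Ω₂}
    {P₁ : Measure Ω₁} [IsProbabilityMeasure P₁] {F₁ : Filtration ℝ≥0 mΩ₁}
    {X₁ : ℝ≥0 → Ω₁ → (Fin d → ℝ)} (hX₁ : IsLevy P₁ F₁ X₁)
    (hcont₁ : ∀ ω, Continuous fun t => X₁ t ω)
    {T₁ : Ω₁ → ℝ≥0∞} (hT₁ : IsStoppingTimeE F₁ T₁) (hpos₁ : 0 < P₁ {ω | 0 < T₁ ω})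
    {P₂ : Measure Ω₂} [IsProbabilityMeasure P₂] {F₂ : Filtration ℝ≥0 mΩ₂}
    {X₂ : ℝ≥0 → Ω₂ → (Fin d → ℝ)} (hX₂ : IsLevy P₂ F₂ X₂)
    (hcont₂ : ∀ ω, Continuous fun t => X₂ t ω)
    {T₂ : Ω₂ → ℝ≥0∞} (hT₂ : IsStoppingTimeE F₂ T₂)
    (heq : Measure.map (fun ω (t : ℝ≥0) => if (t : ℝ≥0∞) < T₁ ω then some (X₁ t ω) else none) P₁
      = Measure.map (fun ω (t : ℝ≥0) => if (t : ℝ≥0∞) < T₂ ω then some (X₂ t ω) else none) P₂)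
    (L : StrongDual ℝ (Fin d → ℝ)) (t : ℝ≥0) : cf P₁ X₁ L t = cf P₂ X₂ L t := by
  have hH : ∀ s t : ℝ≥0, s ≤ t → HH P₁ X₁ T₁ L s t = HH P₂ X₂ T₂ L s t := by
    intro s t hst
    rw [HH_obs hX₁ hT₁ L hst, HH_obs hX₂ hT₂ L hst, heq]
  set p : ℝ := P₁.real {ω | 0 < T₁ ω} with hp
  have hp0 : 0 < p := ENNReal.toReal_pos hpos₁.ne' (measure_ne_top _ _)
  -- a short horizon on which the observables are bounded below
  obtain ⟨δ, hδ, hre⟩ : ∃ δ : ℝ≥0, 0 < δ ∧ ∀ s < δ, p / 2 ≤ (HH P₁ X₁ T₁ L s s).re := by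
    have h1 : Tendsto (fun s : ℝ≥0 => (HH P₁ X₁ T₁ L s s).re) (nhds 0) (nhds p) := by
      have := (Complex.continuous_re.tendsto _).comp (HH_tendsto hX₁ hcont₁ hT₁ L)
      exact this
    have h2 := h1.eventually (lt_mem_nhds (half_lt_self hp0))
    rw [Metric.eventually_nhds_iff] at h2
    obtain ⟨ε, hε, h2⟩ := h2
    refine ⟨⟨ε, hε.le⟩, hε, fun s hs => (h2 ?_).le⟩
    rw [NNReal.dist_eq]
    have hsε : (s : ℝ) < ε := NNReal.coe_lt_coe.2 hs
    simpa using hsε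
  -- equality for short times
  have hshort : ∀ r : ℝ≥0, r < δ → cf P₁ X₁ L r = cf P₂ X₂ L r := by
    intro r hr
    have hbound : ∀ n : ℕ, 1 ≤ n → ‖cf P₁ X₁ L r - cf P₂ X₂ L r‖ ≤
        2 / p * ‖DD P₁ X₁ T₁ L (r / n) n - DD P₂ X₂ T₂ L (r / n) n‖ := by
      intro n hn
      have hn0 : (n : ℝ≥0) ≠ 0 := by positivity
      set h : ℝ≥0 := r / n with hh
      have hnh : (n : ℝ≥0) * h = r := mul_div_cancel₀ _ hn0
      have d1 := decomp hX₁ hT₁ L h n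
      have d2 := decomp hX₂ hT₂ L h n
      set c : ℂ := ∑ k ∈ Finset.range n, HH P₁ X₁ T₁ L (k * h) (k * h) with hc
      have c2 : ∑ k ∈ Finset.range n, HH P₂ X₂ T₂ L (k * h) (k * h) = c :=
        Finset.sum_congr rfl fun k _ => (hH _ _ le_rfl).symm
      have r2 : ∑ k ∈ Finset.range n, (HH P₂ X₂ T₂ L ((k + 1 : ℕ) * h) ((k + 1 : ℕ) * h)
          - HH P₂ X₂ T₂ L (k * h) ((k + 1 : ℕ) * h)) =
          ∑ k ∈ Finset.range n, (HH P₁ X₁ T₁ L ((k + 1 : ℕ) * h) ((k + 1 : ℕ) * h)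
          - HH P₁ X₁ T₁ L (k * h) ((k + 1 : ℕ) * h)) := by
        refine Finset.sum_congr rfl fun k _ => ?_
        rw [hH _ _ le_rfl, hH (k * h)]
        gcongr
        simp
      rw [c2, r2] at d2
      have hdiff : c * (cf P₁ X₁ L h - cf P₂ X₂ L h) = DD P₁ X₁ T₁ L h n - DD P₂ X₂ T₂ L h n := by
        linear_combination d1 - d2
      have hcn : n * (p / 2) ≤ ‖c‖ := by
        refine le_trans ?_ (Complex.re_le_norm c)
        rw [hc, Complex.re_sum]
        calc (n : ℝ) * (p / 2) = ∑ k ∈ Finset.range n, p / 2 := by simp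
          _ ≤ _ := by
            refine Finset.sum_le_sum fun k hk => hre _ ?_
            refine lt_of_le_of_lt ?_ hr
            rw [← hnh]
            gcongr
            exact (Finset.mem_range.1 hk).le
      have e1 : cf P₁ X₁ L r = cf P₁ X₁ L h ^ n := by rw [← cf_nat hX₁, hnh]
      have e2 : cf P₂ X₂ L r = cf P₂ X₂ L h ^ n := by rw [← cf_nat hX₂, hnh]
      rw [e1, e2, ← hdiff, norm_mul]
      refine (pow_diff _ _ (cf_norm L h) (cf_norm L h) n).trans ?_
      have : n * (p / 2) * ‖cf P₁ X₁ L h - cf P₂ X₂ L h‖ ≤ ‖c‖ * ‖cf P₁ X₁ L h - cf P₂ X₂ L h‖ := by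
        gcongr
      calc _ = 2 / p * (n * (p / 2) * ‖cf P₁ X₁ L h - cf P₂ X₂ L h‖) := by field_simp
        _ ≤ _ := by gcongr
    have hlim : Tendsto (fun n : ℕ =>
        2 / p * ‖DD P₁ X₁ T₁ L (r / n) n - DD P₂ X₂ T₂ L (r / n) n‖) atTop (nhds 0) := by
      have := (((DD_tendsto hX₁ hcont₁ hT₁ L r).sub (DD_tendsto hX₂ hcont₂ hT₂ L r)).norm).const_mul
        (2 / p)
      simpa using this
    have h0 := ge_of_tendsto hlim (eventually_atTop.2 ⟨1, hbound⟩)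
    exact sub_eq_zero.1 (norm_le_zero_iff.1 h0)
  -- all times
  obtain ⟨n, hn⟩ := exists_nat_gt (t / δ)
  have hn0 : 0 < (n : ℝ≥0) := lt_of_le_of_lt zero_le hn
  have hlt : t / n < δ := by
    rw [div_lt_iff₀ hn0]
    rwa [div_lt_iff₀ hδ, mul_comm] at hn
  have hnt : (n : ℝ≥0) * (t / n) = t := mul_div_cancel₀ _ hn0.ne'
  rw [← hnt, cf_nat hX₁, cf_nat hX₂, hshort _ hlt]

/-- For continuous Lévy processes (Brownian motions with drift) `X¹, X²`
and stopping times `T¹, T²` positive with positive probability, equality of the laws observed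
on `[0, Tⁱ)` implies equality of the laws observed on `[0, Tⁱ] ∩ [0, ∞)` (by path
continuity), and hence equality of the laws of `X¹` and `X²`. -/
theorem continuous_levy_law_from_open_observation
    {Ω₁ : Type*} {mΩ₁ : MeasurableSpace Ω₁} {Ω₂ : Type*} {mΩ₂ : MeasurableSpace Ω₂} {d : ℕ}
    (P₁ : Measure Ω₁) [IsProbabilityMeasure P₁] (F₁ : Filtration ℝ≥0 mΩ₁)
    (X₁ : ℝ≥0 → Ω₁ → (Fin d → ℝ)) (hX₁ : IsLevy P₁ F₁ X₁)
    (hcont₁ : ∀ ω, Continuous fun t => X₁ t ω)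
    (T₁ : Ω₁ → ℝ≥0∞) (hT₁ : IsStoppingTimeE F₁ T₁) (hpos₁ : 0 < P₁ {ω | 0 < T₁ ω})
    (P₂ : Measure Ω₂) [IsProbabilityMeasure P₂] (F₂ : Filtration ℝ≥0 mΩ₂)
    (X₂ : ℝ≥0 → Ω₂ → (Fin d → ℝ)) (hX₂ : IsLevy P₂ F₂ X₂)
    (hcont₂ : ∀ ω, Continuous fun t => X₂ t ω)
    (T₂ : Ω₂ → ℝ≥0∞) (hT₂ : IsStoppingTimeE F₂ T₂) (hpos₂ : 0 < P₂ {ω | 0 < T₂ ω})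
    (heq : Measure.map (fun ω (t : ℝ≥0) => if (t : ℝ≥0∞) < T₁ ω then some (X₁ t ω) else none) P₁
      = Measure.map (fun ω (t : ℝ≥0) => if (t : ℝ≥0∞) < T₂ ω then some (X₂ t ω) else none) P₂) :
    (Measure.map (fun ω (t : ℝ≥0) => if (t : ℝ≥0∞) ≤ T₁ ω then some (X₁ t ω) else none) P₁
      = Measure.map (fun ω (t : ℝ≥0) => if (t : ℝ≥0∞) ≤ T₂ ω then some (X₂ t ω) else none) P₂) ∧
    Measure.map (fun ω (t : ℝ≥0) => X₁ t ω) P₁ = Measure.map (fun ω (t : ℝ≥0) => X₂ t ω) P₂ := by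
  refine ⟨?_, ?_⟩
  · rw [closed_law hX₁ hcont₁ hT₁, closed_law hX₂ hcont₂ hT₂, heq]
  · exact law_of_cf hX₁ hX₂ (cf_eq hX₁ hcont₁ hT₁ hpos₁ hX₂ hcont₂ hT₂ heq)

end
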